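/- Let F be an algebraically closed field of characteristic 0 and let g be a finite-dimensional simple Lie algebra over F with dim g = 28 (type D4), equipped with a grading by (ℤ/2ℤ)^3 such that dim g_α = 4 for every nonzero α ∈ (ℤ/2ℤ)^3. Then for every nonzero α ∈ (ℤ/2ℤ)^3, the homogeneous component g_α is a Cartan subalgebra of g. -/

import Mathlib

open Module

/-- A grading of the Lie algebra `L` over `F` by the additive group `A`:
a direct sum decomposition into subspaces compatible with the bracket. -/
def IsLieGrading (F : Type*) {A L : Type*} [Field F] [AddCommGroup A] [DecidableEq A]
    [LieRing L] [LieAlgebra F L] (gr : A → Submodule F L) : Prop :=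
  DirectSum.IsInternal gr ∧
    ∀ a b : A, ∀ x ∈ gr a, ∀ y ∈ gr b, ⁅x, y⁆ ∈ gr (a + b)

section Commutator

variable {F R : Type*} [Field F] [Ring R] [Algebra F R]

open Polynomial in
/-- If `D = AB - BA` commutes with `A`, then commutation with `B` acts on polynomials in `A`
as differentiation followed by multiplication by `D`. -/
theorem aeval_mul_sub_mul_aeval {A B D : R} (hD : A * B - B * A = D) (hAD : A * D = D * A)
    (q : F[X]) : aeval A q * B - B * aeval A q = aeval A (derivative q) * D := by
  have hB : A * B = B * A + D := by rw [← hD]; abel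
  induction q using Polynomial.induction_on' with
  | add p q hp hq =>
    simp only [map_add, add_mul, mul_add]
    rw [← hp, ← hq]
    abel
  | monomial n c =>
    have key : ∀ n : ℕ, A ^ n * B - B * A ^ n = (n : R) * (A ^ (n - 1) * D) := by
      intro n
      induction n with
      | zero => simp
      | succ n ih =>
        have h1 : A ^ n * B = B * A ^ n + (n : R) * (A ^ (n - 1) * D) := by
          rw [← ih]; abel
        have h2 : A * ((n : R) * (A ^ (n - 1) * D)) = (n : R) * (A ^ n * D) := by
          rw [← mul_assoc, ← (Nat.cast_commute n A).eq, mul_assoc, ← mul_assoc A]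
          rcases n with _ | n
          · simp
          · rw [Nat.add_sub_cancel, ← pow_succ']
        have h3 : D * A ^ n = A ^ n * D := ((show Commute A D from hAD).pow_left n).eq.symm
        rw [pow_succ', mul_assoc, h1, mul_add, h2, ← mul_assoc, hB, add_mul, mul_assoc, h3]
        push_cast
        noncomm_ring
    rw [derivative_monomial, aeval_monomial, aeval_monomial, mul_assoc, ← mul_assoc B,
      ← Algebra.commutes c B, mul_assoc, ← mul_sub, key, map_mul, map_natCast]
    noncomm_ring

open Polynomial in
/-- **Jacobson's lemma**: a commutator `D = AB - BA` commuting with `A` is nilpotent if `A` is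
algebraic over a field of characteristic zero. -/
theorem isNilpotent_of_commute_commutator [CharZero F] {A B D : R} (hA : IsAlgebraic F A)
    (hD : A * B - B * A = D) (hAD : A * D = D * A) : IsNilpotent D := by
  have hcomm (q : F[X]) : Commute (aeval A q) D :=
    (Algebra.commute_of_mem_adjoin_singleton_of_commute (aeval_mem_adjoin_singleton F A)
      (show Commute D A from hAD.symm)).symm
  suffices H : ∀ (d : ℕ) (q : F[X]) (m : ℕ), q.natDegree = d → q ≠ 0 →
      aeval A q * D ^ m = 0 → IsNilpotent D by
    obtain ⟨q, hq, hqA⟩ := hA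
    exact H _ q 0 rfl hq (by simp [hqA])
  intro d
  induction d using Nat.strong_induction_on with
  | h d ih =>
    intro q m hd hq hm
    rcases eq_or_ne d 0 with rfl | hd0
    · rw [eq_C_of_natDegree_eq_zero hd, aeval_C, ← Algebra.smul_def] at hm
      have hc : q.coeff 0 ≠ 0 := fun h ↦
        hq (by rw [eq_C_of_natDegree_eq_zero hd, h, C_0])
      exact ⟨m, by rw [← inv_smul_smul₀ hc (D ^ m), hm, smul_zero]⟩
    · refine ih _ (hd ▸ natDegree_derivative_lt (hd ▸ hd0)) (derivative q) (m + (1 + m)) rfl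
        (fun h ↦ hd0 (hd ▸ derivative_eq_zero.mp h)) ?_
      rw [pow_add, pow_add, pow_one, ← mul_assoc, ((hcomm _).pow_right m).eq, mul_assoc,
        ← mul_assoc _ D, ← aeval_mul_sub_mul_aeval hD hAD q, sub_mul, mul_assoc B, hm, mul_sub,
        mul_zero, mul_zero, sub_zero, mul_assoc, ← mul_assoc, ← ((hcomm q).pow_right m).eq, hm,
        zero_mul]

end Commutator

section Engel

variable {F L : Type*} [Field F] [LieRing L] [LieAlgebra F L] [FiniteDimensional F L]

/-- Over an infinite field, an abelian subalgebra contains an element whose Engel subalgebra is the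
smallest one. -/
theorem exists_mem_forall_engel_le [Infinite F] (U : LieSubalgebra F L) [IsLieAbelian U] :
    ∃ t ∈ U, ∀ u ∈ U, LieSubalgebra.engel F t ≤ LieSubalgebra.engel F u := by
  set f : U → ℕ := fun u ↦ finrank F (LieSubalgebra.engel F (u : L))
  set t : U := Function.argmin f
  refine ⟨t, t.2, fun u hu ↦ ?_⟩
  have hcard : (finrank F L : Cardinal) ≤ Cardinal.mk F :=
    Cardinal.natCast_le_aleph0.trans (Cardinal.aleph0_le_mk F)
  refine LieAlgebra.engel_isBot_of_isMin hcard U ⟨LieSubalgebra.engel F (t : L), t, t.2, rfl⟩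
    ?_ ?_ ⟨_, u, hu, rfl⟩
  · intro y hy
    refine (LieSubalgebra.mem_engel_iff F _ y).mpr ⟨1, ?_⟩
    simpa using congrArg Subtype.val (trivial_lie_zero U U t ⟨y, hy⟩)
  · rintro ⟨_, v, hv, rfl⟩ hvt
    have h : f t ≤ f ⟨v, hv⟩ := Function.argmin_le f _
    have : LieSubalgebra.engel F v = LieSubalgebra.engel F (t : L) :=
      LieSubalgebra.toSubmodule_injective (Submodule.eq_of_le_of_finrank_le hvt h)
    exact this.ge

end Engel

section KillingForm

variable {F L : Type*} [Field F] [LieRing L] [LieAlgebra F L]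

theorem killingForm_eq_zero_of_isNilpotent_ad {x y : L} (hx : IsNilpotent (LieAlgebra.ad F L x))
    (hxy : ⁅x, y⁆ = 0) : killingForm F L x y = 0 := by
  have hcomm : Commute (LieAlgebra.ad F L x) (LieAlgebra.ad F L y) := by
    ext z
    simp [leibniz_lie x y z, hxy]
  rw [killingForm_apply_apply]
  exact (LinearMap.isNilpotent_trace_of_isNilpotent (hcomm.isNilpotent_mul_right hx)).eq_zero

theorem eq_zero_of_killingForm_eq_zero [LieAlgebra.IsKilling F L] {x : L}
    (h : ∀ y, killingForm F L x y = 0) : x = 0 :=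
  (LieAlgebra.IsKilling.killingForm_nondegenerate F L).1 x h

/-- If `[t, [t, y]] = 0` in characteristic zero, then `[t, y]` is ad-nilpotent. -/
theorem isNilpotent_ad_lie [FiniteDimensional F L] [CharZero F] {t y : L} (h : ⁅t, ⁅t, y⁆⁆ = 0) :
    IsNilpotent (LieAlgebra.ad F L ⁅t, y⁆) := by
  refine isNilpotent_of_commute_commutator (F := F) (A := LieAlgebra.ad F L t)
    (B := LieAlgebra.ad F L y) (Algebra.IsAlgebraic.isAlgebraic _) ?_ ?_
  · ext z
    simp
  · ext z
    have := leibniz_lie t ⁅t, y⁆ z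
    rw [h, zero_lie, zero_add] at this
    simpa using this

end KillingForm

section SymmetricPair

variable {F L : Type*} [Field F] [LieRing L] [LieAlgebra F L] [FiniteDimensional F L]
  [CharZero F] [LieAlgebra.IsSimple F L] {s V : Submodule F L}

/-- Let `L = s + V` be a symmetric decomposition of a simple Lie algebra. A nonzero element of the
center of `s` acts injectively on `V`. -/
theorem eq_zero_of_lie_center_eq_zero (htop : s ⊔ V = ⊤)
    (hsV : ∀ x ∈ s, ∀ v ∈ V, ⁅x, v⁆ ∈ V) (hVV : ∀ v ∈ V, ∀ w ∈ V, ⁅v, w⁆ ∈ s)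
    (hκ : ∀ x ∈ s, ∀ v ∈ V, killingForm F L x v = 0)
    {z : L} (hzs : z ∈ s) (hz : ∀ x ∈ s, ⁅z, x⁆ = 0) (hz0 : z ≠ 0)
    {v : L} (hv : v ∈ V) (hzv : ⁅z, v⁆ = 0) : v = 0 := by
  have hdec (l : L) : ∃ x ∈ s, ∃ w ∈ V, x + w = l :=
    Submodule.mem_sup.mp (htop ▸ Submodule.mem_top)
  set f := LieAlgebra.ad F L z with hf
  have hfV (m : ℕ) : ∀ w ∈ V, (f ^ m) w ∈ V := by
    induction m with
    | zero => simp
    | succ m ih => intro w hw; rw [pow_succ', Module.End.mul_apply]; exact hsV z hzs _ (ih w hw)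
  have hnil : ¬ IsNilpotent f := by
    refine fun h ↦ hz0 (eq_zero_of_killingForm_eq_zero (F := F) fun l ↦ ?_)
    obtain ⟨x, hx, w, hw, rfl⟩ := hdec l
    rw [map_add, killingForm_eq_zero_of_isNilpotent_ad h (hz x hx), hκ z hzs w hw, add_zero]
  obtain ⟨n, hn1, hn⟩ : ∃ n, 1 ≤ n ∧ IsCompl (LinearMap.ker (f ^ n)) (LinearMap.range (f ^ n)) :=
    ((Filter.eventually_ge_atTop 1).and f.eventually_isCompl_ker_pow_range_pow).exists
  have hfs : ∀ x ∈ s, (f ^ n) x = 0 := by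
    intro x hx
    obtain ⟨m, rfl⟩ := Nat.exists_eq_add_of_le' hn1
    rw [pow_succ, Module.End.mul_apply, hf, LieAlgebra.ad_apply, hz x hx, map_zero]
  have hker (m : ℕ) : ∀ k ∈ V, (f ^ m) k = 0 → ∀ w ∈ V, ⁅k, (f ^ m) w⁆ = 0 := by
    induction m with
    | zero => intro k _ hk w _; simp_all
    | succ m ih =>
      intro k hkV hk w hw
      have h1 := hz _ (hVV k hkV _ (hfV m w hw))
      rw [leibniz_lie, ih ⁅z, k⁆ (hsV z hzs k hkV) (by
        rwa [pow_succ, Module.End.mul_apply] at hk) w hw, zero_add] at h1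
      rwa [pow_succ', Module.End.mul_apply]
  have hrange : ∀ k ∈ V, (f ^ n) k = 0 → ∀ l, ⁅k, (f ^ n) l⁆ = 0 := by
    intro k hkV hk l
    obtain ⟨x, hx, w, hw, rfl⟩ := hdec l
    rw [map_add, hfs x hx, zero_add]
    exact hker n k hkV hk w hw
  have hsker : ∀ x ∈ s, ∀ k, (f ^ n) k = 0 → (f ^ n) ⁅x, k⁆ = 0 := by
    intro x hx k hk
    have hcomm : Commute (LieAlgebra.ad F L x) f := by
      ext l
      have := leibniz_lie z x l
      rw [hz x hx, zero_lie, zero_add] at this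
      simpa [hf] using this.symm
    have := LinearMap.congr_fun (hcomm.pow_right n).eq k
    simp only [Module.End.mul_apply, LieAlgebra.ad_apply, hk, lie_zero] at this
    exact this.symm
  -- the centralizer of the Fitting null component of `f` on `V`
  let J : LieIdeal F L :=
    { carrier := {y | ∀ k ∈ V, (f ^ n) k = 0 → ⁅k, y⁆ = 0}
      add_mem' := fun {a b} ha hb k hkV hk ↦ by rw [lie_add, ha k hkV hk, hb k hkV hk, add_zero]
      zero_mem' := fun k _ _ ↦ lie_zero k
      smul_mem' := fun c a ha k hkV hk ↦ by rw [lie_smul, ha k hkV hk, smul_zero]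
      lie_mem := by
        intro l y hy k hkV hk
        obtain ⟨x, hx, w, hw, rfl⟩ := hdec l
        obtain ⟨k', hk', _, ⟨u, rfl⟩, hw'⟩ := Submodule.mem_sup.mp
          (show w ∈ LinearMap.ker (f ^ n) ⊔ LinearMap.range (f ^ n) from
            hn.sup_eq_top ▸ Submodule.mem_top)
        have hu : (f ^ n) u ∈ V := by
          obtain ⟨x', hx', v', hv', rfl⟩ := hdec u
          rw [map_add, hfs x' hx', zero_add]
          exact hfV n v' hv'
        have hk'V : k' ∈ V := by
          rw [← add_sub_cancel_right k' ((f ^ n) u), hw']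
          exact sub_mem hw hu
        have h1 : ⁅k, ⁅x, y⁆⁆ = 0 := by
          rw [leibniz_lie, hy k hkV hk, lie_zero, add_zero, ← lie_skew k x, neg_lie,
            hy _ (hsV x hx k hkV) (hsker x hx k hk), neg_zero]
        have h2 : ⁅k, ⁅(f ^ n) u, y⁆⁆ = 0 := by
          rw [leibniz_lie, hrange k hkV hk, hy k hkV hk, lie_zero, zero_lie, add_zero]
        rw [← hw', add_lie, add_lie, hy k' hk'V hk', zero_add, lie_add, h1, h2, add_zero] }
  have hJ : J = ⊤ := by
    refine (LieAlgebra.IsSimple.eq_bot_or_eq_top (R := F) J).resolve_left fun hbot ↦ hnil ⟨n, ?_⟩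
    ext l
    have : (f ^ n) l ∈ J := fun k hkV hk ↦ hrange k hkV hk l
    rw [hbot] at this
    simpa using this
  suffices v ∈ LieAlgebra.center F L by simpa using this
  refine (LieModule.mem_maxTrivSubmodule F L L v).mpr fun l ↦ ?_
  have hl : l ∈ J := hJ ▸ LieSubmodule.mem_top l
  rw [← lie_skew, neg_eq_zero]
  refine hl v hv ?_
  obtain ⟨m, rfl⟩ := Nat.exists_eq_add_of_le' hn1
  rw [pow_succ, Module.End.mul_apply, hf, LieAlgebra.ad_apply, hzv, map_zero]

/-- The fixed subalgebra `s` of a symmetric decomposition `L = s + V` of a simple Lie algebra has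
center of dimension at most one. -/
theorem exists_eq_smul_of_mem_center [IsAlgClosed F] (htop : s ⊔ V = ⊤) (hV : V ≠ ⊥)
    (hsV : ∀ x ∈ s, ∀ v ∈ V, ⁅x, v⁆ ∈ V) (hVV : ∀ v ∈ V, ∀ w ∈ V, ⁅v, w⁆ ∈ s)
    (hκ : ∀ x ∈ s, ∀ v ∈ V, killingForm F L x v = 0)
    {x y : L} (hxs : x ∈ s) (hx : ∀ l ∈ s, ⁅x, l⁆ = 0) (hys : y ∈ s) (hy : ∀ l ∈ s, ⁅y, l⁆ = 0)
    (hy0 : y ≠ 0) : ∃ μ : F, x = μ • y := by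
  have : Nontrivial V := Submodule.nontrivial_iff_ne_bot.mpr hV
  let fx : Module.End F V := (LieAlgebra.ad F L x).restrict (hsV x hxs)
  let fy : Module.End F V := (LieAlgebra.ad F L y).restrict (hsV y hys)
  have hinj : Function.Injective fy := by
    refine (injective_iff_map_eq_zero fy).mpr fun v hv ↦ Subtype.ext ?_
    exact eq_zero_of_lie_center_eq_zero htop hsV hVV hκ hys hy hy0 v.2 (congrArg Subtype.val hv)
  let e := LinearEquiv.ofInjectiveEndo fy hinj
  obtain ⟨μ, hμ⟩ := Module.End.exists_eigenvalue (e.symm.toLinearMap ∘ₗ fx)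
  obtain ⟨v, hv⟩ := hμ.exists_hasEigenvector
  have hv' : fx v = μ • fy v := by
    have h := congrArg e hv.apply_eq_smul
    rw [LinearMap.comp_apply, LinearEquiv.coe_coe, LinearEquiv.apply_symm_apply, map_smul] at h
    exact h
  refine ⟨μ, sub_eq_zero.mp (by_contra fun hne ↦ hv.2 (Subtype.ext ?_))⟩
  refine eq_zero_of_lie_center_eq_zero htop hsV hVV hκ (sub_mem hxs (s.smul_mem μ hys)) ?_ hne
    v.2 ?_
  · intro l hl
    rw [sub_lie, smul_lie, hx l hl, hy l hl, smul_zero, sub_zero]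
  · rw [sub_lie, smul_lie, sub_eq_zero]
    exact congrArg Subtype.val hv'

end SymmetricPair

namespace IsLieGrading

section General

variable {F A L : Type*} [Field F] [AddCommGroup A] [DecidableEq A] [LieRing L] [LieAlgebra F L]
  {gr : A → Submodule F L}

theorem lie_mem_iSup (hgr : IsLieGrading F gr) {S T R : Set A}
    (h : ∀ a ∈ S, ∀ b ∈ T, a + b ∈ R) {x y : L} (hx : x ∈ ⨆ a ∈ S, gr a)
    (hy : y ∈ ⨆ b ∈ T, gr b) : ⁅x, y⁆ ∈ ⨆ c ∈ R, gr c := by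
  have h1 : ∀ a ∈ S, ∀ x ∈ gr a, ⁅x, y⁆ ∈ ⨆ c ∈ R, gr c := by
    intro a ha x hx
    have : (⨆ b ∈ T, gr b) ≤ (⨆ c ∈ R, gr c).comap (LieAlgebra.ad F L x : L →ₗ[F] L) :=
      iSup₂_le fun b hb w hw ↦ Submodule.mem_iSup_of_mem (a + b)
        (Submodule.mem_iSup_of_mem (h a ha b hb) (hgr.2 a b x hx w hw))
    exact this hy
  have : (⨆ a ∈ S, gr a) ≤ (⨆ c ∈ R, gr c).comap (LieAlgebra.ad F L y : L →ₗ[F] L) := by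
    refine iSup₂_le fun a ha w hw ↦ ?_
    rw [Submodule.mem_comap, LieAlgebra.ad_apply, ← lie_skew]
    exact neg_mem (h1 a ha w hw)
  have hyx := this hx
  rw [Submodule.mem_comap, LieAlgebra.ad_apply] at hyx
  rw [← lie_skew]
  exact neg_mem hyx

theorem killingForm_eq_zero [FiniteDimensional F L] (hgr : IsLieGrading F gr) {a b : A}
    (hab : a + b ≠ 0) {x y : L} (hx : x ∈ gr a) (hy : y ∈ gr b) : killingForm F L x y = 0 := by
  rw [killingForm_apply_apply]
  refine LinearMap.trace_eq_zero_of_mapsTo_ne hgr.1 (fun c ↦ a + (b + c)) (fun c hc ↦ hab ?_)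
    fun c z hz ↦ hgr.2 a _ x hx _ (hgr.2 b c y hy z hz)
  rwa [← add_assoc, add_eq_right] at hc

theorem killingForm_eq_zero_of_mem_iSup [FiniteDimensional F L] (hgr : IsLieGrading F gr)
    {S T : Set A} (h : ∀ a ∈ S, ∀ b ∈ T, a + b ≠ 0) {x y : L} (hx : x ∈ ⨆ a ∈ S, gr a)
    (hy : y ∈ ⨆ b ∈ T, gr b) : killingForm F L x y = 0 := by
  have h1 : ∀ a ∈ S, ∀ x ∈ gr a, killingForm F L x y = 0 := by
    intro a ha x hx
    have : (⨆ b ∈ T, gr b) ≤ LinearMap.ker (killingForm F L x) :=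
      iSup₂_le fun b hb w hw ↦ hgr.killingForm_eq_zero (h a ha b hb) hx hw
    exact this hy
  have : (⨆ a ∈ S, gr a) ≤ LinearMap.ker ((killingForm F L).flip y) :=
    iSup₂_le fun a ha w hw ↦ h1 a ha w hw
  exact this hx

/-- The Killing form pairs opposite components nondegenerately. -/
theorem eq_zero_of_forall_killingForm_eq_zero [FiniteDimensional F L] [LieAlgebra.IsKilling F L]
    (hgr : IsLieGrading F gr) {a b : A} (hab : a + b = 0) {x : L} (hx : x ∈ gr a)
    (h : ∀ y ∈ gr b, killingForm F L x y = 0) : x = 0 := by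
  refine eq_zero_of_killingForm_eq_zero (F := F) fun y ↦ ?_
  have : (⨆ c, gr c) ≤ LinearMap.ker (killingForm F L x) := by
    refine iSup_le fun c w hw ↦ ?_
    rcases eq_or_ne (a + c) 0 with hac | hac
    · obtain rfl : c = b := add_left_cancel (hac.trans hab.symm)
      exact h w hw
    · exact hgr.killingForm_eq_zero hac hx hw
  exact this (hgr.1.submodule_iSup_eq_top ▸ Submodule.mem_top)

end General

section Elementary

/-! Gradings with trivial neutral component by a group of exponent two. -/

variable {F A L : Type*} [Field F] [AddCommGroup A] [DecidableEq A] [LieRing L] [LieAlgebra F L]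
  {gr : A → Submodule F L}

theorem lie_eq_zero_of_mem (hgr : IsLieGrading F gr) (h0 : gr 0 = ⊥) {a : A} (ha : a + a = 0)
    {x y : L} (hx : x ∈ gr a) (hy : y ∈ gr a) : ⁅x, y⁆ = 0 := by
  have := hgr.2 a a x hx y hy
  rwa [ha, h0, Submodule.mem_bot] at this

/-- A homogeneous component as an abelian subalgebra. -/
def component (hgr : IsLieGrading F gr) (h0 : gr 0 = ⊥) {a : A} (ha : a + a = 0) :
    LieSubalgebra F L :=
  { gr a with
    lie_mem' := fun hx hy ↦ by
      rw [hgr.lie_eq_zero_of_mem h0 ha hx hy]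
      exact (gr a).zero_mem }

theorem isLieAbelian_component (hgr : IsLieGrading F gr) (h0 : gr 0 = ⊥) {a : A}
    (ha : a + a = 0) : IsLieAbelian (hgr.component h0 ha) :=
  ⟨fun x y ↦ Subtype.ext (hgr.lie_eq_zero_of_mem h0 ha x.2 y.2)⟩

variable [FiniteDimensional F L] [LieAlgebra.IsKilling F L]

theorem eq_zero_of_isNilpotent_ad (hgr : IsLieGrading F gr) (h0 : gr 0 = ⊥) {a : A}
    (ha : a + a = 0) {x : L} (hx : x ∈ gr a) (hnil : IsNilpotent (LieAlgebra.ad F L x)) :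
    x = 0 :=
  hgr.eq_zero_of_forall_killingForm_eq_zero ha hx fun _ hy ↦
    killingForm_eq_zero_of_isNilpotent_ad hnil (hgr.lie_eq_zero_of_mem h0 ha hx hy)

/-- The generalized null space of a homogeneous element agrees with its centralizer on
homogeneous elements. -/
theorem lie_eq_zero_of_mem_engel [CharZero F] (hgr : IsLieGrading F gr) (h0 : gr 0 = ⊥)
    (h2 : ∀ a : A, a + a = 0) {a b : A} {t y : L} (ht : t ∈ gr a) (hy : y ∈ gr b)
    (h : y ∈ LieSubalgebra.engel F t) : ⁅t, y⁆ = 0 := by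
  obtain ⟨n, hn⟩ := (LieSubalgebra.mem_engel_iff F t y).mp h
  induction n generalizing b y with
  | zero => rw [pow_zero, Module.End.one_apply] at hn; rw [hn, lie_zero]
  | succ n ih =>
    rw [pow_succ, Module.End.mul_apply, LieAlgebra.ad_apply] at hn
    have hty := hgr.2 a b t ht y hy
    have := ih hty ((LieSubalgebra.mem_engel_iff F t _).mpr ⟨n, hn⟩) hn
    exact hgr.eq_zero_of_isNilpotent_ad h0 (h2 _) hty (isNilpotent_ad_lie this)

/-- An element of `gr b` which centralizes `gr a` centralizes `gr (a + b)`. -/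
theorem lie_eq_zero_of_mem_add (hgr : IsLieGrading F gr) (h2 : ∀ a : A, a + a = 0) {a b : A}
    {x : L} (hx : x ∈ gr b) (hxa : ∀ t ∈ gr a, ⁅x, t⁆ = 0) {y : L} (hy : y ∈ gr (a + b)) :
    ⁅x, y⁆ = 0 := by
  have hxy : ⁅x, y⁆ ∈ gr a := by
    have := hgr.2 b (a + b) x hx y hy
    rwa [add_comm a b, ← add_assoc, h2, zero_add] at this
  refine hgr.eq_zero_of_forall_killingForm_eq_zero (h2 a) hxy fun t ht ↦ ?_
  rw [killingForm, LieModule.traceForm_apply_lie_apply', hxa t ht, map_zero, neg_zero]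

/-- If the centralizer of `gr a` meets `gr b`, then it meets `gr (a + b)`, provided these
components have the same dimension. -/
theorem exists_ne_zero_forall_lie_eq_zero [CharZero F] (hgr : IsLieGrading F gr)
    (h0 : gr 0 = ⊥) (h2 : ∀ a : A, a + a = 0) {a b : A}
    (hdim : finrank F (gr (a + b)) = finrank F (gr b)) {x : L} (hx : x ∈ gr b) (hx0 : x ≠ 0)
    (hxa : ∀ t ∈ gr a, ⁅x, t⁆ = 0) :
    ∃ y ∈ gr (a + b), y ≠ 0 ∧ ∀ t ∈ gr a, ⁅y, t⁆ = 0 := by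
  have := hgr.isLieAbelian_component h0 (h2 a)
  have : Infinite F := Infinite.of_injective _ (Nat.cast_injective (R := F))
  obtain ⟨t, ht, hmin⟩ := exists_mem_forall_engel_le (hgr.component h0 (h2 a))
  let B : gr (a + b) →ₗ[F] Module.Dual F (gr b) :=
    ((killingForm F L ∘ₗ (LieAlgebra.ad F L t : L →ₗ[F] L)).domRestrict₁₂ (gr (a + b)) (gr b))
  have hB (q : gr (a + b)) (p : gr b) : B q p = killingForm F L ⁅t, (q : L)⁆ p := rfl
  have hninj : ¬ Function.Injective B := by
    intro hinj
    have hsurj := (LinearMap.injective_iff_surjective_of_finrank_eq_finrank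
      (hdim.trans Subspace.dual_finrank_eq.symm)).mp hinj
    refine hx0 (congrArg Subtype.val ((Module.forall_dual_apply_eq_zero_iff F
      (⟨x, hx⟩ : gr b)).mp fun φ ↦ ?_))
    obtain ⟨q, rfl⟩ := hsurj φ
    rw [hB, killingForm, LieModule.traceForm_apply_lie_apply', ← lie_skew]
    simp [hxa t ht]
  obtain ⟨q, hq, hq0⟩ : ∃ q, B q = 0 ∧ q ≠ 0 := by
    simpa [injective_iff_map_eq_zero] using hninj
  have htq : ⁅t, (q : L)⁆ = 0 := by
    have hmem : ⁅t, (q : L)⁆ ∈ gr b := by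
      have := hgr.2 a (a + b) t ht q q.2
      rwa [← add_assoc, h2, zero_add] at this
    exact hgr.eq_zero_of_forall_killingForm_eq_zero (h2 b) hmem fun p hp ↦
      LinearMap.congr_fun hq ⟨p, hp⟩
  refine ⟨q, q.2, by simpa using hq0, fun u hu ↦ ?_⟩
  rw [← lie_skew, hgr.lie_eq_zero_of_mem_engel h0 h2 hu q.2
    (hmin u hu ((LieSubalgebra.mem_engel_iff F t _).mpr ⟨1, by simpa using htq⟩)), neg_zero]

end Elementary

/-- If the centralizer of each component `gr a` is `gr a` itself, then `gr a` is a Cartan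
subalgebra. -/
theorem isCartanSubalgebra_component {F A L : Type*} [Field F] [AddCommGroup A] [DecidableEq A]
    [LieRing L] [LieAlgebra F L] [FiniteDimensional F L] [LieAlgebra.IsKilling F L]
    {gr : A → Submodule F L} (hgr : IsLieGrading F gr) (h0 : gr 0 = ⊥) {a : A} (ha : a + a = 0)
    (hcent : ∀ b ≠ a, ∀ x ∈ gr b, (∀ t ∈ gr a, ⁅x, t⁆ = 0) → x = 0) :
    (hgr.component h0 ha).IsCartanSubalgebra := by
  have := hgr.isLieAbelian_component h0 ha
  refine ⟨inferInstance, le_antisymm (fun y hy ↦ ?_) (LieSubalgebra.le_normalizer _)⟩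
  rw [LieSubalgebra.mem_normalizer_iff] at hy
  classical
  let _ : DirectSum.Decomposition gr := hgr.1.chooseDecomposition
  let p (b : A) : L := DirectSum.decompose gr y b
  have hp (b : A) : p b ∈ gr b := SetLike.coe_mem _
  have hsum : ∑ b ∈ (DirectSum.decompose gr y).support, p b = y :=
    DirectSum.sum_support_decompose gr y
  have hsupp {b : A} (hb : b ∉ (DirectSum.decompose gr y).support) : p b = 0 := by
    simpa [p] using hb
  have hzero (b : A) (hba : b ≠ a) : p b = 0 := by
    rcases eq_or_ne b 0 with rfl | hb0
    · simpa [h0] using hp 0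
    refine hcent b hba _ (hp b) fun t ht ↦ ?_
    refine hgr.eq_zero_of_forall_killingForm_eq_zero (add_neg_cancel (b + a))
      (hgr.2 b a _ (hp b) t ht) fun q hq ↦ ?_
    have hyt : killingForm F L ⁅y, t⁆ q = 0 :=
      hgr.killingForm_eq_zero (by simpa using hb0) (hy t ht) hq
    rwa [← hsum, sum_lie, map_sum, LinearMap.sum_apply,
      Finset.sum_eq_single b (fun c _ hcb ↦ hgr.killingForm_eq_zero (a := c + a) (fun h ↦ hcb ?_)
        (hgr.2 c a _ (hp c) t ht) hq) (fun hb ↦ by simp [hsupp hb])] at hyt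
    exact add_right_cancel (add_neg_eq_zero.mp h)
  rw [← hsum, Finset.sum_eq_single a (fun b _ hba ↦ hzero b hba) hsupp]
  exact hp a

end IsLieGrading

open Matrix in
/-- Two distinct nonzero vectors of `𝔽₂³` span a plane, cut out by a nonzero linear form. -/
theorem exists_dotProduct_eq_zero_imp {a b : Fin 3 → ZMod 2} (ha : a ≠ 0) (hb : b ≠ 0)
    (hab : a ≠ b) : ∃ d : Fin 3 → ZMod 2, (∃ c, d ⬝ᵥ c = 1) ∧ d ⬝ᵥ a = 0 ∧ d ⬝ᵥ b = 0 ∧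
      ∀ c, d ⬝ᵥ c = 0 → c = 0 ∨ c = a ∨ c = b ∨ c = a + b := by
  have key : ∀ a b : Fin 3 → ZMod 2, a ≠ 0 → b ≠ 0 → a ≠ b →
      (∃ c, (a ⨯₃ b) ⬝ᵥ c = 1) ∧ (a ⨯₃ b) ⬝ᵥ a = 0 ∧ (a ⨯₃ b) ⬝ᵥ b = 0 ∧
        ∀ c, (a ⨯₃ b) ⬝ᵥ c = 0 → c = 0 ∨ c = a ∨ c = b ∨ c = a + b := by
    decide
  exact ⟨a ⨯₃ b, key a b ha hb hab⟩

theorem IsLieGrading.eq_bot_zero_of_finrank {F A L : Type*} [Field F] [AddCommGroup A]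
    [Fintype A] [DecidableEq A] [LieRing L] [LieAlgebra F L] [FiniteDimensional F L]
    {gr : A → Submodule F L} (hgr : IsLieGrading F gr)
    (h : ∑ a ∈ Finset.univ.erase 0, finrank F (gr a) = finrank F L) : gr 0 = ⊥ := by
  have hsum : finrank F L = ∑ a, finrank F (gr a) := by
    rw [← finrank_directSum, (LinearEquiv.ofBijective (DirectSum.coeLinearMap gr) hgr.1).finrank_eq]
  rw [← Finset.add_sum_erase _ _ (Finset.mem_univ 0), h, right_eq_add] at hsum
  exact Submodule.finrank_eq_zero.mp hsum

open Matrix in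
/-- The centralizer of a nonzero component meets every other component trivially. -/
theorem IsLieGrading.eq_zero_of_forall_lie_eq_zero {F L : Type*} [Field F] [IsAlgClosed F]
    [CharZero F] [LieRing L] [LieAlgebra F L] [FiniteDimensional F L] [LieAlgebra.IsSimple F L]
    {gr : (Fin 3 → ZMod 2) → Submodule F L} (hgr : IsLieGrading F gr) (h0 : gr 0 = ⊥)
    {n : ℕ} (hn : n ≠ 0) (hdims : ∀ a ≠ 0, finrank F (gr a) = n) {a b : Fin 3 → ZMod 2}
    (ha : a ≠ 0) (hba : b ≠ a) {x : L} (hx : x ∈ gr b) (hxa : ∀ t ∈ gr a, ⁅x, t⁆ = 0) :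
    x = 0 := by
  have h2 (c : Fin 3 → ZMod 2) : c + c = 0 := CharTwo.add_self_eq_zero c
  by_contra hx0
  have hb : b ≠ 0 := by
    rintro rfl
    exact hx0 (by simpa [h0] using hx)
  have hab : a + b ≠ 0 := fun h ↦ hba (add_left_cancel (h.trans (h2 a).symm))
  obtain ⟨y, hy, hy0, hya⟩ := hgr.exists_ne_zero_forall_lie_eq_zero h0 h2
    ((hdims _ hab).trans (hdims b hb).symm) hx hx0 hxa
  obtain ⟨d, ⟨e, he⟩, hda, hdb, hd⟩ := exists_dotProduct_eq_zero_imp ha hb hba.symm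
  let s : Submodule F L := ⨆ c ∈ {c | d ⬝ᵥ c = 0}, gr c
  let V : Submodule F L := ⨆ c ∈ {c | d ⬝ᵥ c = 1}, gr c
  have mem_s {c : Fin 3 → ZMod 2} (hc : d ⬝ᵥ c = 0) : gr c ≤ s :=
    le_iSup₂_of_le (f := fun c (_ : c ∈ {c | d ⬝ᵥ c = 0}) ↦ gr c) c hc le_rfl
  have mem_V {c : Fin 3 → ZMod 2} (hc : d ⬝ᵥ c = 1) : gr c ≤ V :=
    le_iSup₂_of_le (f := fun c (_ : c ∈ {c | d ⬝ᵥ c = 1}) ↦ gr c) c hc le_rfl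
  have htop : s ⊔ V = ⊤ := by
    rw [eq_top_iff, ← hgr.1.submodule_iSup_eq_top]
    refine iSup_le fun c ↦ ?_
    rcases (by decide : ∀ r : ZMod 2, r = 0 ∨ r = 1) (d ⬝ᵥ c) with hc | hc
    · exact (mem_s hc).trans le_sup_left
    · exact (mem_V hc).trans le_sup_right
  have hV : V ≠ ⊥ := by
    intro hV
    have he0 : e ≠ 0 := by rintro rfl; simp at he
    have hbot : gr e = ⊥ := le_bot_iff.mp (hV ▸ mem_V he)
    exact hn (by rw [← hdims e he0, hbot, finrank_bot])
  have central {z : L} (hza : ∀ t ∈ gr a, ⁅z, t⁆ = 0) (hzb : ∀ t ∈ gr b, ⁅z, t⁆ = 0)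
      (hzab : ∀ t ∈ gr (a + b), ⁅z, t⁆ = 0) : ∀ l ∈ s, ⁅z, l⁆ = 0 := by
    have : s ≤ LinearMap.ker (LieAlgebra.ad F L z : L →ₗ[F] L) := by
      refine iSup₂_le fun c hc w hw ↦ ?_
      rcases hd c hc with rfl | rfl | rfl | rfl
      · rw [h0, Submodule.mem_bot] at hw
        simp [hw]
      exacts [hza w hw, hzb w hw, hzab w hw]
    exact fun l hl ↦ this hl
  have hxs : ∀ l ∈ s, ⁅x, l⁆ = 0 := central hxa
    (fun t ht ↦ hgr.lie_eq_zero_of_mem h0 (h2 b) hx ht)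
    fun t ht ↦ hgr.lie_eq_zero_of_mem_add h2 hx hxa ht
  have hys : ∀ l ∈ s, ⁅y, l⁆ = 0 := central hya
    (fun t ht ↦ hgr.lie_eq_zero_of_mem_add h2 hy hya
      (by rwa [← add_assoc, h2, zero_add]))
    fun t ht ↦ hgr.lie_eq_zero_of_mem h0 (h2 (a + b)) hy ht
  obtain ⟨μ, hμ⟩ := exists_eq_smul_of_mem_center htop hV
    (fun x hx v hv ↦ hgr.lie_mem_iSup (fun c hc c' hc' ↦ by
      simp_all [dotProduct_add]) hx hv)
    (fun v hv w hw ↦ hgr.lie_mem_iSup (fun c hc c' hc' ↦ by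
      simp only [Set.mem_ofPred_eq] at hc hc' ⊢
      rw [dotProduct_add, hc, hc']; rfl) hv hw)
    (fun x hx v hv ↦ hgr.killingForm_eq_zero_of_mem_iSup (fun c hc c' hc' h ↦ by
      simp only [Set.mem_ofPred_eq] at hc hc'
      have := congrArg (d ⬝ᵥ ·) h
      simp [dotProduct_add, hc, hc'] at this) hx hv)
    (mem_s hdb hx) hxs (mem_s (by rw [dotProduct_add, hda, hdb, add_zero]) hy) hys hy0
  have hdisj : Disjoint (gr b) (gr (a + b)) :=
    hgr.1.submodule_iSupIndep.pairwiseDisjoint (fun h ↦ ha (right_eq_add.mp h))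
  exact hx0 (Submodule.disjoint_def.mp hdisj x hx (hμ ▸ (gr (a + b)).smul_mem μ hy))

theorem components_are_cartan_D4
    (F : Type*) [Field F] [IsAlgClosed F] [CharZero F]
    (L : Type*) [LieRing L] [LieAlgebra F L] [FiniteDimensional F L]
    [LieAlgebra.IsSimple F L] (hdim : finrank F L = 28)
    (gr : (Fin 3 → ZMod 2) → Submodule F L) (hgr : IsLieGrading F gr)
    (hdims : ∀ a : Fin 3 → ZMod 2, a ≠ 0 → finrank F (gr a) = 4) :
    ∀ α : Fin 3 → ZMod 2, α ≠ 0 →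
      ∃ H : LieSubalgebra F L, H.toSubmodule = gr α ∧ H.IsCartanSubalgebra := by
  have h0 : gr 0 = ⊥ := by
    refine hgr.eq_bot_zero_of_finrank ?_
    rw [Finset.sum_congr rfl fun a ha ↦ hdims a (Finset.ne_of_mem_erase ha), hdim]
    simp
  intro α hα
  refine ⟨hgr.component h0 (CharTwo.add_self_eq_zero α), rfl,
    hgr.isCartanSubalgebra_component h0 _ fun b hb x hx hxα ↦ ?_⟩
  exact hgr.eq_zero_of_forall_lie_eq_zero h0 four_ne_zero hdims hα hb hx hxα
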